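/- arXiv:0903.3068 — 2 statements merged into one kernel-verified Lean document; each statement's English description precedes it below -/
import Mathlib

section
/- Let Φ⁺(x,t) := t^{−α⁺} φ⁺(x/√t). For each pair of constants a₁, a₂ with 0 < a₁ < 1/(4Λ) ≤ 1/(4λ) < a₂, there exists a constant C > 1 such that C⁻¹ t^{−α⁺} exp(−a₂|x|²/t) ≤ Φ⁺(x,t) ≤ C t^{−α⁺} exp(−a₁|x|²/t) for all (x,t) ∈ ℝⁿ×ℝ₊. -/
noncomputable section

open Filter Matrix Real Set
open scoped Topology

/-- Euclidean `n`-space `ℝⁿ`. -/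
abbrev En (n : ℕ) := EuclideanSpace ℝ (Fin n)

/-- `n × n` real matrices. -/
abbrev Mat (n : ℕ) := Matrix (Fin n) (Fin n) ℝ

/-- The set of symmetric positive definite matrices whose eigenvalues all lie in `[lam, Lam]`. -/
def PucciMatrices (n : ℕ) (lam Lam : ℝ) : Set (Mat n) :=
  { A | ∃ hA : A.IsHermitian, ∀ i, hA.eigenvalues i ∈ Set.Icc lam Lam }

/-- The Pucci maximal operator `P⁺(M) = sup {-tr(AM) : A ∈ PucciMatrices}`. -/
def PucciPlus (n : ℕ) (lam Lam : ℝ) (M : Mat n) : ℝ :=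
  sSup ((fun A => -(A * M).trace) '' PucciMatrices n lam Lam)

/-- The Pucci minimal operator `P⁻(M) = inf {-tr(AM) : A ∈ PucciMatrices}`. -/
def PucciMinus (n : ℕ) (lam Lam : ℝ) (M : Mat n) : ℝ :=
  sInf ((fun A => -(A * M).trace) '' PucciMatrices n lam Lam)

/-- `F` is uniformly elliptic with ellipticity constants `lam ≤ Lam`. -/
def UniformlyElliptic (n : ℕ) (lam Lam : ℝ) (F : Mat n → ℝ) : Prop :=
  ∀ M N : Mat n, M.IsSymm → N.IsSymm →
    PucciMinus n lam Lam (M - N) ≤ F M - F N ∧ F M - F N ≤ PucciPlus n lam Lam (M - N)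

/-- `F` is positively homogeneous of order one. -/
def PositivelyHomogeneous (n : ℕ) (F : Mat n → ℝ) : Prop :=
  ∀ (M : Mat n), ∀ η : ℝ, 0 ≤ η → F (η • M) = η * F M

/-- The Hessian matrix of `φ : ℝⁿ → ℝ` at a point `y`. -/
def hess (n : ℕ) (φ : En n → ℝ) (y : En n) : Mat n :=
  Matrix.of fun i j =>
    fderiv ℝ (fun z => fderiv ℝ φ z (EuclideanSpace.single j 1)) y (EuclideanSpace.single i 1)

/-- Viscosity subsolution of the elliptic equation `G(D²u, Du, u, y) = 0` on `Ω`,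
i.e. `G[u] ≤ 0` in the viscosity sense. -/
def ViscSubE (n : ℕ) (Ω : Set (En n))
    (G : Mat n → (En n →L[ℝ] ℝ) → ℝ → En n → ℝ) (u : En n → ℝ) : Prop :=
  ∀ y ∈ Ω, ∀ φ : En n → ℝ, ContDiff ℝ 2 φ →
    IsLocalMaxOn (fun z => u z - φ z) Ω y →
    G (hess n φ y) (fderiv ℝ φ y) (u y) y ≤ 0

/-- Viscosity supersolution of the elliptic equation `G(D²u, Du, u, y) = 0` on `Ω`,
i.e. `G[u] ≥ 0` in the viscosity sense. -/
def ViscSupE (n : ℕ) (Ω : Set (En n))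
    (G : Mat n → (En n →L[ℝ] ℝ) → ℝ → En n → ℝ) (u : En n → ℝ) : Prop :=
  ∀ y ∈ Ω, ∀ φ : En n → ℝ, ContDiff ℝ 2 φ →
    IsLocalMinOn (fun z => u z - φ z) Ω y →
    0 ≤ G (hess n φ y) (fderiv ℝ φ y) (u y) y

/-- Viscosity solution of the elliptic equation `G(D²u, Du, u, y) = 0` on `Ω`. -/
def ViscSolE (n : ℕ) (Ω : Set (En n))
    (G : Mat n → (En n →L[ℝ] ℝ) → ℝ → En n → ℝ) (u : En n → ℝ) : Prop :=
  ViscSubE n Ω G u ∧ ViscSupE n Ω G u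

/-- Time derivative of `φ : ℝⁿ × ℝ → ℝ` at `p = (x, t)`. -/
def tderiv (n : ℕ) (φ : En n × ℝ → ℝ) (p : En n × ℝ) : ℝ :=
  deriv (fun s => φ (p.1, s)) p.2

/-- Spatial Hessian of `φ : ℝⁿ × ℝ → ℝ` at `p = (x, t)`. -/
def shess (n : ℕ) (φ : En n × ℝ → ℝ) (p : En n × ℝ) : Mat n :=
  hess n (fun z => φ (z, p.2)) p.1

/-- Spatial differential of `φ : ℝⁿ × ℝ → ℝ` at `p = (x, t)`. -/
def sgrad (n : ℕ) (φ : En n × ℝ → ℝ) (p : En n × ℝ) : En n →L[ℝ] ℝ :=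
  fderiv ℝ (fun z => φ (z, p.2)) p.1

/-- Viscosity subsolution of the parabolic equation `u_t + G(D²u, Du, u, (x,t)) = 0` on `Ω`. -/
def ViscSubP (n : ℕ) (Ω : Set (En n × ℝ))
    (G : Mat n → (En n →L[ℝ] ℝ) → ℝ → En n × ℝ → ℝ) (u : En n × ℝ → ℝ) : Prop :=
  ∀ p ∈ Ω, ∀ φ : En n × ℝ → ℝ, ContDiff ℝ 2 φ →
    IsLocalMaxOn (fun q => u q - φ q) Ω p →
    tderiv n φ p + G (shess n φ p) (sgrad n φ p) (u p) p ≤ 0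

/-- Viscosity supersolution of the parabolic equation `u_t + G(D²u, Du, u, (x,t)) = 0` on `Ω`. -/
def ViscSupP (n : ℕ) (Ω : Set (En n × ℝ))
    (G : Mat n → (En n →L[ℝ] ℝ) → ℝ → En n × ℝ → ℝ) (u : En n × ℝ → ℝ) : Prop :=
  ∀ p ∈ Ω, ∀ φ : En n × ℝ → ℝ, ContDiff ℝ 2 φ →
    IsLocalMinOn (fun q => u q - φ q) Ω p →
    0 ≤ tderiv n φ p + G (shess n φ p) (sgrad n φ p) (u p) p

/-- Viscosity solution of the parabolic equation `u_t + G(D²u, Du, u, (x,t)) = 0` on `Ω`. -/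
def ViscSolP (n : ℕ) (Ω : Set (En n × ℝ))
    (G : Mat n → (En n →L[ℝ] ℝ) → ℝ → En n × ℝ → ℝ) (u : En n × ℝ → ℝ) : Prop :=
  ViscSubP n Ω G u ∧ ViscSupP n Ω G u

/-- The parabolic domain `ℝⁿ × ℝ₊`. -/
def Qset (n : ℕ) : Set (En n × ℝ) := {p | 0 < p.2}

/-- The elliptic operator `F(D²u) - (1/2) y·Du - α u - f(y)`. -/
def Fop (n : ℕ) (F : Mat n → ℝ) (α : ℝ) (f : En n → ℝ) :
    Mat n → (En n →L[ℝ] ℝ) → ℝ → En n → ℝ :=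
  fun M p v y => F M - (1/2) * p y - α * v - f y

/-- Membership in the space `X` with weight `b`: continuity and finiteness of the norm. -/
def memX (n : ℕ) (b : ℝ) (u : En n → ℝ) : Prop :=
  Continuous u ∧ BddAbove (Set.range fun y : En n => |u y| * Real.exp (b * ‖y‖ ^ 2) / (1 + ‖y‖ ^ 2))

/-- The norm `‖u‖_X = sup_y |u(y)| e^{b|y|²} / (1 + |y|²)`. -/
def normX (n : ℕ) (b : ℝ) (u : En n → ℝ) : ℝ :=
  sSup (Set.range fun y : En n => |u y| * Real.exp (b * ‖y‖ ^ 2) / (1 + ‖y‖ ^ 2))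

/-- The positive anomalous exponent `α⁺(F)`. -/
def alphaPlus (n : ℕ) (lam Lam : ℝ) (F : Mat n → ℝ) : ℝ :=
  sSup { α : ℝ | ∃ φ : En n → ℝ, memX n (1/(8*Lam)) φ ∧ (∀ y, 0 ≤ φ y) ∧ φ ≠ 0 ∧
    ViscSupE n Set.univ (Fop n F α (fun _ => 0)) φ }

/-- `Φ` is a positive self-similar solution of `u_t + F(D²u) = 0` with exponent `α`,
with a Gaussian upper bound at time one. -/
def IsSelfSimilarPlus (n : ℕ) (F : Mat n → ℝ) (α : ℝ) (Φ : En n × ℝ → ℝ) : Prop :=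
  ContinuousOn Φ (Qset n) ∧
  (∀ p ∈ Qset n, 0 < Φ p) ∧
  ViscSolP n (Qset n) (fun M _ _ _ => F M) Φ ∧
  (∀ σ : ℝ, 0 < σ → ∀ x : En n, ∀ t : ℝ, 0 < t →
    Φ (x, t) = σ ^ α * Φ (Real.sqrt σ • x, σ * t)) ∧
  (∃ C : ℝ, 0 < C ∧ ∃ a : ℝ, 0 < a ∧ ∀ x : En n, Φ (x, 1) ≤ C * Real.exp (-a * ‖x‖ ^ 2))

/-- `Φ` is a negative self-similar solution of `u_t + F(D²u) = 0` with exponent `α`,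
with a Gaussian lower bound at time one. -/
def IsSelfSimilarMinus (n : ℕ) (F : Mat n → ℝ) (α : ℝ) (Φ : En n × ℝ → ℝ) : Prop :=
  ContinuousOn Φ (Qset n) ∧
  (∀ p ∈ Qset n, Φ p < 0) ∧
  ViscSolP n (Qset n) (fun M _ _ _ => F M) Φ ∧
  (∀ σ : ℝ, 0 < σ → ∀ x : En n, ∀ t : ℝ, 0 < t →
    Φ (x, t) = σ ^ α * Φ (Real.sqrt σ • x, σ * t)) ∧
  (∃ C : ℝ, 0 < C ∧ ∃ a : ℝ, 0 < a ∧ ∀ x : En n, -Φ (x, 1) ≤ C * Real.exp (-a * ‖x‖ ^ 2))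

/-- The set `S` of locally uniform sequential limits of the rescalings
`u^σ(x,t) = σ^α u(σ^{1/2} x, σ t)` as `σ → ∞`. -/
def limitSet (n : ℕ) (α : ℝ) (u : En n × ℝ → ℝ) : Set (En n × ℝ → ℝ) :=
  { U | ContinuousOn U (Qset n) ∧ ∃ σ : ℕ → ℝ,
      Tendsto σ atTop atTop ∧
      TendstoLocallyUniformlyOn
        (fun k (p : En n × ℝ) => (σ k) ^ α * u (Real.sqrt (σ k) • p.1, σ k * p.2))
        U atTop (Qset n) }

/-- The Gaussian `y ↦ e^{-a|y|²}`. -/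
def gaussian (n : ℕ) (a : ℝ) (y : En n) : ℝ := Real.exp (-a * ‖y‖ ^ 2)

/-- A linear combination of two Gaussians. -/
def gaussianComb (n : ℕ) (c a d b : ℝ) (y : En n) : ℝ :=
  c * gaussian n a y + d * gaussian n b y

lemma gaussian_pos (n : ℕ) (a : ℝ) (y : En n) : 0 < gaussian n a y := Real.exp_pos _

lemma contDiff_gaussian (n : ℕ) (a : ℝ) : ContDiff ℝ 2 (gaussian n a) :=
  (contDiff_const.mul (contDiff_norm_sq ℝ)).exp

lemma contDiff_gaussianComb (n : ℕ) (c a d b : ℝ) : ContDiff ℝ 2 (gaussianComb n c a d b) :=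
  (contDiff_const.mul (contDiff_gaussian n a)).add (contDiff_const.mul (contDiff_gaussian n b))

lemma hasFDerivAt_gaussian (n : ℕ) (a : ℝ) (y : En n) :
    HasFDerivAt (gaussian n a) ((-2 * a * gaussian n a y) • innerSL ℝ y) y := by
  have h := (((hasStrictFDerivAt_norm_sq y).hasFDerivAt).const_mul (-a)).exp
  refine h.congr_fderiv ?_
  ext v
  simp [gaussian]
  ring

lemma fderiv_gaussianComb (n : ℕ) (c a d b : ℝ) (y v : En n) :
    fderiv ℝ (gaussianComb n c a d b) y v =
      (c * (-2 * a * gaussian n a y) + d * (-2 * b * gaussian n b y)) * inner ℝ y v := by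
  have h := ((hasFDerivAt_gaussian n a y).const_mul c).add
    ((hasFDerivAt_gaussian n b y).const_mul d)
  have h' : HasFDerivAt (gaussianComb n c a d b) _ y := h
  rw [h'.fderiv]
  simp
  ring

lemma hess_gaussianComb (n : ℕ) (c a d b : ℝ) (y : En n) :
    hess n (gaussianComb n c a d b) y =
      (-2 * (c * a * gaussian n a y + d * b * gaussian n b y)) • (1 : Mat n) +
      (4 * (c * a ^ 2 * gaussian n a y + d * b ^ 2 * gaussian n b y)) •
        Matrix.vecMulVec y.ofLp y.ofLp := by
  ext i j
  have hj : HasFDerivAt (fun z : En n => inner ℝ z (EuclideanSpace.single j (1 : ℝ)))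
      (innerSL ℝ (EuclideanSpace.single j (1 : ℝ) : En n)) y := by
    have := (innerSL ℝ (EuclideanSpace.single j (1 : ℝ) : En n)).hasFDerivAt (x := y)
    refine this.congr_of_eventuallyEq (Eventually.of_forall fun z => ?_)
    simp [real_inner_comm]
  have h := (((((hasFDerivAt_gaussian n a y).const_mul (-2 * a)).const_mul c).add
    (((hasFDerivAt_gaussian n b y).const_mul (-2 * b)).const_mul d))).mul hj
  have h' : HasFDerivAt (fun z => fderiv ℝ (gaussianComb n c a d b) z
      (EuclideanSpace.single j 1)) _ y :=
    h.congr_of_eventuallyEq (Eventually.of_forall fun z => fderiv_gaussianComb n c a d b z _)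
  simp only [hess, Matrix.of_apply]
  rw [h'.fderiv]
  by_cases hij : i = j
  · subst hij
    simp [Matrix.vecMulVec_apply, EuclideanSpace.inner_single_right]
    ring
  · simp [Matrix.vecMulVec_apply, EuclideanSpace.inner_single_right, hij]
    ring

lemma isSymm_hess_gaussianComb (n : ℕ) (c a d b : ℝ) (y : En n) :
    (hess n (gaussianComb n c a d b) y).IsSymm := by
  rw [hess_gaussianComb]
  ext i j
  simp [Matrix.vecMulVec_apply, Matrix.one_apply, eq_comm, mul_comm]

lemma smul_one_mem_PucciMatrices (n : ℕ) {lam Lam : ℝ} (h : lam ≤ Lam) :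
    lam • (1 : Mat n) ∈ PucciMatrices n lam Lam := by
  have hA : (lam • (1 : Mat n)).IsHermitian := by
    ext i j
    simp [Matrix.one_apply, eq_comm]
  refine ⟨hA, fun i => ?_⟩
  have hv := hA.mulVec_eigenvectorBasis i
  have hne : hA.eigenvectorBasis i ≠ 0 := hA.eigenvectorBasis.orthonormal.ne_zero i
  have : hA.eigenvalues i = lam := by
    by_contra hcon
    apply hne
    ext k
    have hk := congrFun hv k
    simp [Matrix.smul_mulVec] at hk
    rcases hk with hk | hk
    · exact absurd hk.symm hcon
    · simpa using hk
  simp [this, h]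

lemma PucciMatrices.trace_le {n : ℕ} {lam Lam : ℝ} {A : Mat n} (hA : A ∈ PucciMatrices n lam Lam) :
    A.trace ≤ n * Lam := by
  obtain ⟨hA, hev⟩ := hA
  rw [hA.trace_eq_sum_eigenvalues]
  calc _ ≤ ∑ _i : Fin n, Lam := Finset.sum_le_sum fun i _ => (hev i).2
    _ = n * Lam := by simp

lemma PucciMatrices.trace_nonneg {n : ℕ} {lam Lam : ℝ} (hlam : 0 < lam) {A : Mat n}
    (hA : A ∈ PucciMatrices n lam Lam) : 0 ≤ A.trace := by
  obtain ⟨hA, hev⟩ := hA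
  rw [hA.trace_eq_sum_eigenvalues]
  exact Finset.sum_nonneg fun i _ => by simpa using hlam.le.trans (hev i).1

lemma PucciMatrices.dotProduct_mulVec_mem {n : ℕ} {lam Lam : ℝ} {A : Mat n}
    (hA : A ∈ PucciMatrices n lam Lam) (y : En n) :
    y.ofLp ⬝ᵥ (A *ᵥ y.ofLp) ∈ Set.Icc (lam * ‖y‖ ^ 2) (Lam * ‖y‖ ^ 2) := by
  obtain ⟨hA, hev⟩ := hA
  set e := hA.eigenvectorBasis
  have hsymm := Matrix.isSymmetric_toEuclideanLin_iff.2 hA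
  have happ : ∀ i, Matrix.toEuclideanLin A (e i) = hA.eigenvalues i • e i := fun i => by
    ext k
    have := congrFun (hA.mulVec_eigenvectorBasis i) k
    simpa [Matrix.toLpLin_apply] using this
  have hq : y.ofLp ⬝ᵥ (A *ᵥ y.ofLp) = ∑ i, hA.eigenvalues i * inner ℝ y (e i) ^ 2 := by
    have h1 : y.ofLp ⬝ᵥ (A *ᵥ y.ofLp) = inner ℝ y (Matrix.toEuclideanLin A y) := by
      simp [PiLp.inner_apply, dotProduct, Matrix.toLpLin_apply, mul_comm]
    rw [h1, ← e.sum_inner_mul_inner]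
    refine Finset.sum_congr rfl fun i _ => ?_
    rw [← hsymm, happ, inner_smul_left, real_inner_comm y]
    simp
    ring
  have hn : ‖y‖ ^ 2 = ∑ i, inner ℝ y (e i) ^ 2 := by
    rw [← real_inner_self_eq_norm_sq, ← e.sum_inner_mul_inner]
    refine Finset.sum_congr rfl fun i _ => ?_
    rw [real_inner_comm y]
    ring
  rw [hq, hn, Finset.mul_sum, Finset.mul_sum]
  exact ⟨Finset.sum_le_sum fun i _ => mul_le_mul_of_nonneg_right (hev i).1 (sq_nonneg _),
    Finset.sum_le_sum fun i _ => mul_le_mul_of_nonneg_right (hev i).2 (sq_nonneg _)⟩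

lemma trace_mul_hess_gaussianComb (n : ℕ) (c a d b : ℝ) (y : En n) (A : Mat n) :
    (A * hess n (gaussianComb n c a d b) y).trace =
      -2 * (c * a * gaussian n a y + d * b * gaussian n b y) * A.trace +
      4 * (c * a ^ 2 * gaussian n a y + d * b ^ 2 * gaussian n b y) *
        (y.ofLp ⬝ᵥ (A *ᵥ y.ofLp)) := by
  rw [hess_gaussianComb, mul_add, Matrix.trace_add]
  simp only [Matrix.mul_smul, Matrix.trace_smul, mul_one, smul_eq_mul,
    Matrix.mul_vecMulVec, Matrix.trace_vecMulVec, dotProduct_comm]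

lemma PositivelyHomogeneous.map_zero {n : ℕ} {F : Mat n → ℝ} (hF : PositivelyHomogeneous n F) :
    F 0 = 0 := by
  simpa using hF 0 0 le_rfl

lemma UniformlyElliptic.le_of_forall_le {n : ℕ} {lam Lam : ℝ} (hLam : lam ≤ Lam) {F : Mat n → ℝ}
    (hF : UniformlyElliptic n lam Lam F) (hFh : PositivelyHomogeneous n F) {M : Mat n}
    (hM : M.IsSymm) {m : ℝ} (h : ∀ A ∈ PucciMatrices n lam Lam, m ≤ -(A * M).trace) :
    m ≤ F M := by
  have h1 := (hF M 0 hM Matrix.isSymm_zero).1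
  rw [hFh.map_zero, sub_zero, sub_zero] at h1
  refine le_trans
    (le_csInf (Set.Nonempty.image _ ⟨_, smul_one_mem_PucciMatrices n hLam⟩) ?_) h1
  rintro _ ⟨A, hA, rfl⟩
  exact h A hA

lemma UniformlyElliptic.le_of_forall_ge {n : ℕ} {lam Lam : ℝ} (hLam : lam ≤ Lam) {F : Mat n → ℝ}
    (hF : UniformlyElliptic n lam Lam F) (hFh : PositivelyHomogeneous n F) {M : Mat n}
    (hM : M.IsSymm) {m : ℝ} (h : ∀ A ∈ PucciMatrices n lam Lam, -(A * M).trace ≤ m) :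
    F M ≤ m := by
  have h1 := (hF M 0 hM Matrix.isSymm_zero).2
  rw [hFh.map_zero, sub_zero, sub_zero] at h1
  refine le_trans h1
    (csSup_le (Set.Nonempty.image _ ⟨_, smul_one_mem_PucciMatrices n hLam⟩) ?_)
  rintro _ ⟨A, hA, rfl⟩
  exact h A hA

/-- A positive combination of slowly decaying Gaussians is a strict supersolution far out. -/
lemma Fop_gaussianComb_pos {n : ℕ} {lam Lam : ℝ} (hlam : 0 < lam) (hLam : lam ≤ Lam)
    {F : Mat n → ℝ} (hF : UniformlyElliptic n lam Lam F) (hFh : PositivelyHomogeneous n F)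
    {α c a d b : ℝ} (hc : 0 < c) (hd : 0 < d) (ha : 0 < a) (hb : 0 < b) {y : En n}
    (hya : α < a * (1 - 4 * a * Lam) * ‖y‖ ^ 2) (hyb : α < b * (1 - 4 * b * Lam) * ‖y‖ ^ 2) :
    0 < Fop n F α (fun _ => 0) (hess n (gaussianComb n c a d b) y)
      (fderiv ℝ (gaussianComb n c a d b) y) (gaussianComb n c a d b y) y := by
  have hga := mul_pos hc (gaussian_pos n a y)
  have hgb := mul_pos hd (gaussian_pos n b y)
  have key := hF.le_of_forall_le hLam hFh (isSymm_hess_gaussianComb n c a d b y)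
    (m := -(4 * (c * a ^ 2 * gaussian n a y + d * b ^ 2 * gaussian n b y) * (Lam * ‖y‖ ^ 2)))
    fun A hA => by
      rw [trace_mul_hess_gaussianComb]
      have h1 : 0 ≤ 2 * (c * a * gaussian n a y + d * b * gaussian n b y) * A.trace :=
        mul_nonneg (by nlinarith [mul_pos ha hga, mul_pos hb hgb]) (PucciMatrices.trace_nonneg hlam hA)
      have h2 := mul_le_mul_of_nonneg_left (PucciMatrices.dotProduct_mulVec_mem hA y).2
        (show 0 ≤ 4 * (c * a ^ 2 * gaussian n a y + d * b ^ 2 * gaussian n b y) by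
          nlinarith [mul_pos (pow_pos ha 2) hga, mul_pos (pow_pos hb 2) hgb])
      linarith
  simp only [Fop, fderiv_gaussianComb, real_inner_self_eq_norm_sq]
  have e1 := mul_pos hga (sub_pos.2 hya)
  have e2 := mul_pos hgb (sub_pos.2 hyb)
  simp only [gaussianComb]
  linarith

/-- A fast Gaussian minus a slow one is a strict subsolution far out. -/
lemma Fop_gaussianComb_neg {n : ℕ} {lam Lam : ℝ} (hlam : 0 < lam) (hLam : lam ≤ Lam)
    {F : Mat n → ℝ} (hF : UniformlyElliptic n lam Lam F) (hFh : PositivelyHomogeneous n F)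
    {α c a d b : ℝ} (hc : 0 < c) (hd : 0 < d) (ha : 0 < a) (hb : 0 < b) {y : En n}
    (hya : 2 * a * (n * Lam) - α < a * (4 * a * lam - 1) * ‖y‖ ^ 2)
    (hyb : α < b * (1 - 4 * b * Lam) * ‖y‖ ^ 2) :
    Fop n F α (fun _ => 0) (hess n (gaussianComb n c a (-d) b) y)
      (fderiv ℝ (gaussianComb n c a (-d) b) y) (gaussianComb n c a (-d) b y) y < 0 := by
  have hga := mul_pos hc (gaussian_pos n a y)
  have hgb := mul_pos hd (gaussian_pos n b y)
  have key := hF.le_of_forall_ge hLam hFh (isSymm_hess_gaussianComb n c a (-d) b y)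
    (m := c * gaussian n a y * (2 * a * (n * Lam) - 4 * a ^ 2 * (lam * ‖y‖ ^ 2)) +
      d * gaussian n b y * (4 * b ^ 2 * (Lam * ‖y‖ ^ 2)))
    fun A hA => by
      rw [trace_mul_hess_gaussianComb]
      have hq := PucciMatrices.dotProduct_mulVec_mem hA y
      have h1 := mul_le_mul_of_nonneg_left (PucciMatrices.trace_le hA) (mul_pos ha hga).le
      have h2 := mul_nonneg (mul_pos hb hgb).le (PucciMatrices.trace_nonneg hlam hA)
      have h3 := mul_le_mul_of_nonneg_left hq.1 (mul_pos (pow_pos ha 2) hga).le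
      have h4 := mul_le_mul_of_nonneg_left hq.2 (mul_pos (pow_pos hb 2) hgb).le
      linarith
  simp only [Fop, fderiv_gaussianComb, real_inner_self_eq_norm_sq]
  have e1 := mul_pos hga (sub_pos.2 hya)
  have e2 := mul_pos hgb (sub_pos.2 hyb)
  simp only [gaussianComb]
  linarith

lemma gaussianComb_smul (n : ℕ) (s c a d b : ℝ) (y : En n) :
    s * gaussianComb n c a d b y = gaussianComb n (s * c) a (s * d) b y := by
  simp only [gaussianComb]
  ring

lemma gaussian_eq_gaussian_mul_exp (n : ℕ) (a b : ℝ) (y : En n) :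
    gaussian n a y = gaussian n b y * Real.exp (-((a - b) * ‖y‖ ^ 2)) := by
  rw [gaussian, gaussian, ← Real.exp_add]
  ring_nf

lemma tendsto_exp_neg_norm_sq_cocompact (n : ℕ) {c : ℝ} (hc : 0 < c) :
    Tendsto (fun y : En n => Real.exp (-(c * ‖y‖ ^ 2))) (cocompact (En n)) (𝓝 0) :=
  Real.tendsto_exp_neg_atTop_nhds_zero.comp
    (((tendsto_pow_atTop two_ne_zero).comp (tendsto_norm_cocompact_atTop (E := En n))).const_mul_atTop
      hc)

lemma memX_le_gaussian {n : ℕ} {b c : ℝ} {u : En n → ℝ} (hu : memX n b u) (hc : c < b) :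
    ∃ K : ℝ, ∀ y, u y ≤ K * gaussian n c y := by
  obtain ⟨K, hK⟩ := hu.2
  have hK0 : 0 ≤ K := le_trans (by positivity) (hK ⟨0, rfl⟩)
  have hbc := sub_pos.2 hc
  refine ⟨K * (1 + 1 / (b - c)), fun y => ?_⟩
  have h1 : |u y| * Real.exp (b * ‖y‖ ^ 2) / (1 + ‖y‖ ^ 2) ≤ K := hK ⟨y, rfl⟩
  rw [div_le_iff₀ (by positivity)] at h1
  set E := Real.exp ((b - c) * ‖y‖ ^ 2) with hE
  have h2 : 1 + ‖y‖ ^ 2 ≤ (1 + 1 / (b - c)) * E := by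
    have h3 := Real.add_one_le_exp ((b - c) * ‖y‖ ^ 2)
    have h4 : 1 ≤ E := Real.one_le_exp (by positivity)
    have h5 : ‖y‖ ^ 2 ≤ 1 / (b - c) * E := by
      rw [one_div, inv_mul_eq_div, le_div_iff₀ hbc]
      linarith
    linarith
  have h3 : |u y| * Real.exp (b * ‖y‖ ^ 2) ≤ K * ((1 + 1 / (b - c)) * E) :=
    h1.trans (mul_le_mul_of_nonneg_left h2 hK0)
  have h4 : E = gaussian n c y * Real.exp (b * ‖y‖ ^ 2) := by
    rw [hE, gaussian, ← Real.exp_add]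
    ring_nf
  rw [h4] at h3
  refine (le_abs_self _).trans (le_of_mul_le_mul_right ?_ (Real.exp_pos (b * ‖y‖ ^ 2)))
  linarith

/-- On a ball, a continuous function is bounded by a multiple of a positive one. -/
lemma exists_le_mul_of_norm_le {n : ℕ} (R : ℝ) {u v : En n → ℝ} (hu : Continuous u)
    (hv : Continuous v) (hvpos : ∀ y, 0 < v y) :
    ∃ C : ℝ, 0 < C ∧ ∀ y : En n, ‖y‖ ≤ R → u y ≤ C * v y := by
  obtain ⟨C, hC⟩ := ((isCompact_closedBall (0 : En n) R).image
    (hu.div hv fun y => (hvpos y).ne')).bddAbove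
  refine ⟨max C 1, by positivity, fun y hy => ?_⟩
  rw [← div_le_iff₀ (hvpos y)]
  exact (hC ⟨y, by simpa using hy, rfl⟩).trans (le_max_left _ _)

lemma exists_forall_lt_mul_norm_sq (n : ℕ) {k : ℝ} (hk : 0 < k) (α : ℝ) :
    ∃ R : ℝ, ∀ y : En n, R < ‖y‖ → α < k * ‖y‖ ^ 2 := by
  have h := ((tendsto_pow_atTop (α := ℝ) two_ne_zero).const_mul_atTop hk).eventually_gt_atTop α
  obtain ⟨R, hR⟩ := eventually_atTop.1 h
  exact ⟨R, fun y hy => hR _ hy.le⟩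

lemma le_gaussian_of_viscSubE {n : ℕ} {lam Lam : ℝ} (hlam : 0 < lam) (hLam : lam ≤ Lam)
    {F : Mat n → ℝ} (hF : UniformlyElliptic n lam Lam F) (hFh : PositivelyHomogeneous n F)
    {α : ℝ} {u : En n → ℝ} (hmem : memX n (1 / (8 * Lam)) u) (hpos : ∀ y, 0 < u y)
    (hsub : ViscSubE n Set.univ (Fop n F α (fun _ => 0)) u)
    {a : ℝ} (ha : 0 < a) (ha' : a < 1 / (4 * Lam)) :
    ∃ C : ℝ, 0 < C ∧ ∀ y, u y ≤ C * gaussian n a y := by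
  have hL : 0 < Lam := hlam.trans_le hLam
  set b := 1 / (16 * Lam) with hb
  have hb0 : 0 < b := by positivity
  have hbL : b * Lam = 1 / 16 := by rw [hb]; field_simp
  rw [lt_div_iff₀ (by positivity)] at ha'
  obtain ⟨R₁, hR₁⟩ := exists_forall_lt_mul_norm_sq n
    (show 0 < a * (1 - 4 * a * Lam) from mul_pos ha (by linarith)) α
  obtain ⟨R₂, hR₂⟩ := exists_forall_lt_mul_norm_sq n
    (show 0 < b * (1 - 4 * b * Lam) from mul_pos hb0 (by linarith)) α
  obtain ⟨C, hC0, hC⟩ := exists_le_mul_of_norm_le (max R₁ R₂) hmem.1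
    (contDiff_gaussian n a).continuous (gaussian_pos n a)
  refine ⟨C, hC0, fun y => ?_⟩
  have key : ∀ ε : ℝ, 0 < ε → u y ≤ C * gaussianComb n 1 a ε b y := by
    intro ε hε
    set ψ := gaussianComb n 1 a ε b with hψ
    have hψa : ∀ z, gaussian n a z ≤ ψ z := fun z => by
      simp only [hψ, gaussianComb]
      nlinarith [mul_pos hε (gaussian_pos n b z)]
    have hψb : ∀ z, ε * gaussian n b z ≤ ψ z := fun z => by
      simp only [hψ, gaussianComb]
      nlinarith [gaussian_pos n a z]
    have hψpos : ∀ z, 0 < ψ z := fun z => (gaussian_pos n a z).trans_le (hψa z)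
    have hcont : Continuous fun z => u z / ψ z :=
      hmem.1.div (contDiff_gaussianComb n 1 a ε b).continuous fun z => (hψpos z).ne'
    have hq0 : 0 < u 0 / ψ 0 := div_pos (hpos 0) (hψpos 0)
    have hev : ∀ᶠ z in cocompact (En n), u z / ψ z ≤ u 0 / ψ 0 := by
      obtain ⟨K, hK⟩ := memX_le_gaussian hmem (c := 3 / 2 * b) (by
        rw [hb]; field_simp; norm_num)
      have hlim := (tendsto_exp_neg_norm_sq_cocompact n
        (show 0 < 3 / 2 * b - b by linarith)).const_mul K
      rw [mul_zero] at hlim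
      filter_upwards [hlim.eventually_lt_const (mul_pos hq0 hε)] with z hz
      rw [div_le_iff₀ (hψpos z)]
      calc u z ≤ K * gaussian n (3 / 2 * b) z := hK z
        _ = K * Real.exp (-((3 / 2 * b - b) * ‖z‖ ^ 2)) * gaussian n b z := by
          rw [gaussian_eq_gaussian_mul_exp n (3 / 2 * b) b]; ring
        _ ≤ u 0 / ψ 0 * ε * gaussian n b z :=
          mul_le_mul_of_nonneg_right hz.le (gaussian_pos n b z).le
        _ ≤ u 0 / ψ 0 * ψ z := by
          rw [mul_assoc]; exact mul_le_mul_of_nonneg_left (hψb z) hq0.le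
    obtain ⟨z, hz⟩ := hcont.exists_forall_ge' 0 hev
    set s := u z / ψ z with hs
    have hs0 : 0 < s := div_pos (hpos z) (hψpos z)
    have hzR : ‖z‖ ≤ max R₁ R₂ := by
      by_contra! hlt
      have hpos' := Fop_gaussianComb_pos hlam hLam hF hFh (α := α) (mul_pos hs0 one_pos)
        (mul_pos hs0 hε) ha hb0 (hR₁ z ((le_max_left _ _).trans_lt hlt))
        (hR₂ z ((le_max_right _ _).trans_lt hlt))
      have huz : u z = gaussianComb n (s * 1) a (s * ε) b z := by
        rw [← gaussianComb_smul, ← hψ, hs, div_mul_cancel₀ _ (hψpos z).ne']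
      have hle := hsub z (mem_univ z) _ (contDiff_gaussianComb n (s * 1) a (s * ε) b)
        (Eventually.of_forall fun w => by
          have := (div_le_iff₀ (hψpos w)).1 (hz w)
          rw [hψ, gaussianComb_smul] at this
          simp only [← huz]
          linarith)
      rw [huz] at hle
      exact absurd hpos' (not_lt.2 hle)
    have hsC : s ≤ C := (div_le_iff₀ (hψpos z)).2
      ((hC z hzR).trans (mul_le_mul_of_nonneg_left (hψa z) hC0.le))
    exact (div_le_iff₀ (hψpos y)).1 ((hz y).trans hsC)
  have hlim : Tendsto (fun ε : ℝ => C * gaussianComb n 1 a ε b y) (𝓝[>] 0)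
      (𝓝 (C * gaussian n a y)) := by
    have : Continuous fun ε : ℝ => C * gaussianComb n 1 a ε b y := by
      unfold gaussianComb; fun_prop
    simpa [gaussianComb] using this.continuousWithinAt.tendsto (x := (0 : ℝ)) (s := Set.Ioi 0)
  exact ge_of_tendsto hlim (eventually_mem_nhdsWithin.mono key)

lemma gaussian_le_of_viscSupE {n : ℕ} {lam Lam : ℝ} (hlam : 0 < lam) (hLam : lam ≤ Lam)
    {F : Mat n → ℝ} (hF : UniformlyElliptic n lam Lam F) (hFh : PositivelyHomogeneous n F)
    {α : ℝ} {u : En n → ℝ} (hu : Continuous u) (hpos : ∀ y, 0 < u y)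
    (hsup : ViscSupE n Set.univ (Fop n F α (fun _ => 0)) u)
    {a : ℝ} (ha' : 1 / (4 * lam) < a) :
    ∃ C : ℝ, 0 < C ∧ ∀ y, gaussian n a y ≤ C * u y := by
  have hL : 0 < Lam := hlam.trans_le hLam
  set b := 1 / (16 * Lam) with hb
  have hb0 : 0 < b := by positivity
  have hbL : b * Lam = 1 / 16 := by rw [hb]; field_simp
  have ha : 0 < a := lt_trans (by positivity) ha'
  rw [div_lt_iff₀ (by positivity)] at ha'
  have hba : b < a := by
    refine lt_of_mul_lt_mul_right ?_ hL.le
    nlinarith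
  obtain ⟨R₁, hR₁⟩ := exists_forall_lt_mul_norm_sq n
    (show 0 < a * (4 * a * lam - 1) from mul_pos ha (by linarith)) (2 * a * (n * Lam) - α)
  obtain ⟨R₂, hR₂⟩ := exists_forall_lt_mul_norm_sq n
    (show 0 < b * (1 - 4 * b * Lam) from mul_pos hb0 (by linarith)) α
  obtain ⟨C, hC0, hC⟩ := exists_le_mul_of_norm_le (max R₁ R₂)
    (contDiff_gaussian n a).continuous hu hpos
  refine ⟨C, hC0, fun y => ?_⟩
  have key : ∀ ε ∈ Set.Ioo (0 : ℝ) 1, gaussianComb n 1 a (-ε) b y ≤ C * u y := by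
    rintro ε ⟨hε, hε1⟩
    set ψ := gaussianComb n 1 a (-ε) b with hψ
    have hψa : ∀ z, ψ z ≤ gaussian n a z := fun z => by
      simp only [hψ, gaussianComb]
      nlinarith [mul_pos hε (gaussian_pos n b z)]
    have hcont : Continuous fun z => ψ z / u z :=
      (contDiff_gaussianComb n 1 a (-ε) b).continuous.div hu fun z => (hpos z).ne'
    have hψ0 : 0 < ψ 0 := by
      simp [hψ, gaussianComb, gaussian, hε1]
    have hq0 : 0 < ψ 0 / u 0 := div_pos hψ0 (hpos 0)
    have hev : ∀ᶠ z in cocompact (En n), ψ z / u z ≤ ψ 0 / u 0 := by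
      filter_upwards [(tendsto_exp_neg_norm_sq_cocompact n
        (sub_pos.2 hba)).eventually_lt_const hε] with z hz
      refine le_trans (div_nonpos_of_nonpos_of_nonneg ?_ (hpos z).le) hq0.le
      simp only [hψ, gaussianComb]
      rw [gaussian_eq_gaussian_mul_exp n a b]
      nlinarith [mul_lt_mul_of_pos_left hz (gaussian_pos n b z)]
    obtain ⟨z, hz⟩ := hcont.exists_forall_ge' 0 hev
    set s := ψ z / u z with hs
    have hs0 : 0 < s := hq0.trans_le (hz 0)
    have hzR : ‖z‖ ≤ max R₁ R₂ := by
      by_contra! hlt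
      have hneg := Fop_gaussianComb_neg hlam hLam hF hFh (α := α)
        (mul_pos (inv_pos.2 hs0) one_pos)
        (mul_pos (inv_pos.2 hs0) hε) ha hb0 (hR₁ z ((le_max_left _ _).trans_lt hlt))
        (hR₂ z ((le_max_right _ _).trans_lt hlt))
      rw [← mul_neg] at hneg
      have huz : u z = gaussianComb n (s⁻¹ * 1) a (s⁻¹ * -ε) b z := by
        rw [← gaussianComb_smul, ← hψ, eq_inv_mul_iff_mul_eq₀ hs0.ne', hs,
          div_mul_cancel₀ _ (hpos z).ne']
      have hle := hsup z (mem_univ z) _ (contDiff_gaussianComb n (s⁻¹ * 1) a (s⁻¹ * -ε) b)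
        (Eventually.of_forall fun w => by
          have := (inv_mul_le_iff₀ hs0).2 ((div_le_iff₀ (hpos w)).1 (hz w))
          rw [hψ, gaussianComb_smul] at this
          simp only [← huz]
          linarith)
      rw [huz] at hle
      exact absurd hneg (not_lt.2 hle)
    have hsC : s ≤ C := (div_le_iff₀ (hpos z)).2 ((hψa z).trans (hC z hzR))
    exact (div_le_iff₀ (hpos y)).1 ((hz y).trans hsC)
  have hlim : Tendsto (fun ε : ℝ => gaussianComb n 1 a (-ε) b y) (𝓝[>] 0)
      (𝓝 (gaussian n a y)) := by
    have : Continuous fun ε : ℝ => gaussianComb n 1 a (-ε) b y := by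
      unfold gaussianComb; fun_prop
    simpa [gaussianComb] using this.continuousWithinAt.tendsto (x := (0 : ℝ)) (s := Set.Ioi 0)
  exact le_of_tendsto hlim
    (Filter.mem_of_superset (Ioo_mem_nhdsGT (one_pos : (0 : ℝ) < 1)) key)

/-- **Corollary 3.10.** Two-sided Gaussian bounds for the self-similar solution
`Φ⁺(x,t) = t^{-α⁺} φ⁺(x/√t)`: for `0 < a₁ < 1/(4Λ) ≤ 1/(4λ) < a₂` there is `C > 1` with
`C⁻¹ t^{-α⁺} e^{-a₂|x|²/t} ≤ Φ⁺(x,t) ≤ C t^{-α⁺} e^{-a₁|x|²/t}` on `ℝⁿ × ℝ₊`. -/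
theorem Phi_bound_above_and_below (n : ℕ) (hn : 1 ≤ n) (lam Lam : ℝ)
    (hlam : 0 < lam) (hLam : lam ≤ Lam)
    (F : Mat n → ℝ) (hF : UniformlyElliptic n lam Lam F) (hFh : PositivelyHomogeneous n F)
    (φp : En n → ℝ) (hmem : memX n (1/(8*Lam)) φp) (h0 : φp 0 = 1) (hpos : ∀ y, 0 < φp y)
    (hsol : ViscSolE n Set.univ (Fop n F (alphaPlus n lam Lam F) (fun _ => 0)) φp) :
    ∀ a₁ a₂ : ℝ, 0 < a₁ → a₁ < 1/(4*Lam) → 1/(4*lam) < a₂ →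
      ∃ C : ℝ, 1 < C ∧ ∀ (x : En n) (t : ℝ), 0 < t →
        C⁻¹ * t ^ (-(alphaPlus n lam Lam F)) * Real.exp (-a₂ * ‖x‖ ^ 2 / t) ≤
          t ^ (-(alphaPlus n lam Lam F)) * φp ((Real.sqrt t)⁻¹ • x) ∧
        t ^ (-(alphaPlus n lam Lam F)) * φp ((Real.sqrt t)⁻¹ • x) ≤
          C * t ^ (-(alphaPlus n lam Lam F)) * Real.exp (-a₁ * ‖x‖ ^ 2 / t) := by
  intro a₁ a₂ h1 h1' h2
  obtain ⟨C₁, hC₁, hu⟩ := le_gaussian_of_viscSubE hlam hLam hF hFh hmem hpos hsol.1 h1 h1'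
  obtain ⟨C₂, hC₂, hl⟩ := gaussian_le_of_viscSupE hlam hLam hF hFh hmem.1 hpos hsol.2 h2
  have hC : 0 < C₁ + C₂ + 1 := by positivity
  refine ⟨C₁ + C₂ + 1, by linarith, fun x t ht => ?_⟩
  have hg : ∀ a : ℝ, Real.exp (-a * ‖x‖ ^ 2 / t) = gaussian n a ((Real.sqrt t)⁻¹ • x) := fun a => by
    rw [gaussian, norm_smul, mul_pow, norm_inv, inv_pow, Real.norm_eq_abs, sq_abs,
      Real.sq_sqrt ht.le]
    ring_nf
  have hT : 0 < t ^ (-(alphaPlus n lam Lam F)) := Real.rpow_pos_of_pos ht _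
  rw [hg, hg]
  set y := (Real.sqrt t)⁻¹ • x
  constructor
  · rw [mul_comm (C₁ + C₂ + 1)⁻¹, mul_assoc]
    refine mul_le_mul_of_nonneg_left ((inv_mul_le_iff₀ hC).2 ((hl y).trans ?_)) hT.le
    exact mul_le_mul_of_nonneg_right (by linarith) (hpos y).le
  · rw [mul_comm (C₁ + C₂ + 1), mul_assoc]
    refine mul_le_mul_of_nonneg_left ((hu y).trans ?_) hT.le
    exact mul_le_mul_of_nonneg_right (by linarith) (gaussian_pos n a₁ y).le
end
end

section
/- For each a > 1/(4λ), there exist constants r, η > 0 and a function w ∈ C(ℝⁿ×[0,∞)) which is a viscosity subsolution of w_s + P⁺(D²w) − (1/2) y·Dw ≤ 0 in ℝⁿ×ℝ₊, satisfies the initial conditions w(y,0) ≤ e^{−a|y|²} for all |y| ≤ r and w(y,0) ≤ −η e^{−|y|} for all |y| > r, and has the property that for each R > 0 there exists a time S > 0 such that w(y,s) > 0 for every |y| ≤ R and s ≥ S. -/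
noncomputable section

open Filter Matrix Real Set
open scoped Topology

theorem second_deriv_nonneg_of_isLocalMin {h h' : ℝ → ℝ} {h'' x : ℝ} (hmin : IsLocalMin h x)
    (hd : ∀ᶠ t in 𝓝 x, HasDerivAt h (h' t) t) (hdd : HasDerivAt h' h'' x) : 0 ≤ h'' := by
  by_contra! hneg
  have hderiv : deriv h =ᶠ[𝓝 x] h' := hd.mono fun t ht => ht.deriv
  have hdd' : deriv (deriv h) x = h'' := by rw [hderiv.deriv_eq, hdd.deriv]
  have hmax : IsLocalMax h x :=
    isLocalMax_of_deriv_deriv_neg (hdd' ▸ hneg) hmin.deriv_eq_zero hd.self_of_nhds.continuousAt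
  have hconst : h =ᶠ[𝓝 x] fun _ => h x := by
    filter_upwards [hmin, hmax] with t h1 h2 using le_antisymm h2 h1
  have : deriv (deriv h) x = 0 := by
    rw [hconst.deriv.deriv_eq]
    simp
  linarith

theorem trace_mul_eq_sum_eigenvalues {n : ℕ} {A : Mat n} (hA : A.IsHermitian) (M : Mat n) :
    (A * M).trace = ∑ k, hA.eigenvalues k *
      (⇑(hA.eigenvectorBasis k) ⬝ᵥ M *ᵥ ⇑(hA.eigenvectorBasis k)) := by
  conv_lhs => rw [hA.spectral_theorem, Unitary.conjStarAlgAut_apply]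
  rw [mul_assoc, mul_assoc, Matrix.trace_mul_comm, mul_assoc, Matrix.trace]
  refine Finset.sum_congr rfl fun k _ => ?_
  rw [Matrix.diag_apply, Matrix.diagonal_mul]
  simp [Matrix.mul_apply, dotProduct, mulVec, Finset.mul_sum, Finset.sum_mul, mul_assoc]
  exact Finset.sum_comm

theorem smul_one_mem_pucciMatrices {n : ℕ} {lam Lam : ℝ} (h : lam ≤ Lam) :
    lam • (1 : Mat n) ∈ PucciMatrices n lam Lam := by
  have hA : (lam • (1 : Mat n)).IsHermitian := by
    simp [Matrix.IsHermitian]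
  refine ⟨hA, fun i => ?_⟩
  have h1 := hA.mulVec_eigenvectorBasis i
  have hne : ⇑(hA.eigenvectorBasis i) ≠ 0 := fun h0 =>
    hA.eigenvectorBasis.orthonormal.ne_zero i (by ext j; exact congrFun h0 j)
  rw [Matrix.smul_mulVec, Matrix.one_mulVec] at h1
  rw [← smul_left_injective ℝ hne h1]
  exact ⟨le_rfl, h⟩

theorem pucciPlus_le {n : ℕ} {lam Lam c : ℝ} (h : lam ≤ Lam) {M : Mat n}
    (hc : ∀ (b : OrthonormalBasis (Fin n) ℝ (En n)) (e : Fin n → ℝ),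
      (∀ k, lam ≤ e k ∧ e k ≤ Lam) → -∑ k, e k * (⇑(b k) ⬝ᵥ M *ᵥ ⇑(b k)) ≤ c) :
    PucciPlus n lam Lam M ≤ c := by
  refine csSup_le ⟨_, _, smul_one_mem_pucciMatrices h, rfl⟩ ?_
  rintro _ ⟨A, ⟨hA, hev⟩, rfl⟩
  simpa only [trace_mul_eq_sum_eigenvalues hA] using hc hA.eigenvectorBasis _ hev

theorem dotProduct_hess_mulVec {n : ℕ} {φ : En n → ℝ} (hφ : ContDiff ℝ 2 φ) (y v : En n) :
    (v : Fin n → ℝ) ⬝ᵥ hess n φ y *ᵥ (v : Fin n → ℝ) = fderiv ℝ (fderiv ℝ φ) y v v := by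
  have hd : DifferentiableAt ℝ (fderiv ℝ φ) y :=
    ((hφ.fderiv_right (m := 1) le_rfl).differentiable one_ne_zero) y
  have hv : ∑ i, v i • (EuclideanSpace.single i (1 : ℝ) : En n) = v := by
    ext j
    simp [Pi.single_apply]
  have hH : ∀ i j, hess n φ y i j =
      fderiv ℝ (fderiv ℝ φ) y (EuclideanSpace.single i 1) (EuclideanSpace.single j 1) := by
    intro i j
    simp only [hess, Matrix.of_apply]
    rw [fderiv_clm_apply hd (differentiableAt_const _)]
    simp
  conv_rhs => rw [← hv]
  simp only [dotProduct, mulVec, hH, map_sum, map_smul, _root_.sum_apply,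
    _root_.smul_apply, smul_eq_mul, Finset.mul_sum]
  rw [Finset.sum_comm]
  refine Finset.sum_congr rfl fun i _ => Finset.sum_congr rfl fun j _ => ?_
  ring

theorem radial_touching {n : ℕ} {φ : En n → ℝ} (hφ : ContDiff ℝ 2 φ) {g g' : ℝ → ℝ} {g'' : ℝ}
    {y : En n} (hg : ∀ᶠ q in 𝓝 (‖y‖ ^ 2), HasDerivAt g (g' q) q)
    (hg' : HasDerivAt g' g'' (‖y‖ ^ 2))
    (hmin : IsLocalMin (fun z => φ z - g (‖z‖ ^ 2)) y) (v : En n) :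
    fderiv ℝ φ y v = 2 * inner ℝ y v * g' (‖y‖ ^ 2) ∧
    4 * g'' * inner ℝ y v ^ 2 + 2 * g' (‖y‖ ^ 2) * ‖v‖ ^ 2 ≤
      (v : Fin n → ℝ) ⬝ᵥ hess n φ y *ᵥ (v : Fin n → ℝ) := by
  have hl : ∀ t : ℝ, HasDerivAt (fun t : ℝ => y + t • v) v t := fun t => by
    simpa using ((hasDerivAt_id t).smul_const v).const_add y
  have hl0 : y + (0 : ℝ) • v = y := by simp
  have hlc : Tendsto (fun t : ℝ => y + t • v) (𝓝 0) (𝓝 y) := by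
    simpa [ContinuousAt] using (hl 0).continuousAt
  have hq : ∀ t : ℝ, HasDerivAt (fun t : ℝ => ‖y + t • v‖ ^ 2) (2 * inner ℝ (y + t • v) v) t :=
    fun t => (hl t).norm_sq
  have hqc : Tendsto (fun t : ℝ => ‖y + t • v‖ ^ 2) (𝓝 0) (𝓝 (‖y‖ ^ 2)) := by
    simpa [ContinuousAt] using (hq 0).continuousAt
  have hdφ : Differentiable ℝ φ := hφ.differentiable two_ne_zero
  have hdφ' : Differentiable ℝ (fderiv ℝ φ) :=
    (hφ.fderiv_right (m := 1) le_rfl).differentiable one_ne_zero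
  have hh : ∀ᶠ t in 𝓝 (0 : ℝ), HasDerivAt (fun t => φ (y + t • v) - g (‖y + t • v‖ ^ 2))
      (fderiv ℝ φ (y + t • v) v - g' (‖y + t • v‖ ^ 2) * (2 * inner ℝ (y + t • v) v)) t := by
    filter_upwards [hqc.eventually hg] with t ht
    exact ((hdφ _).hasFDerivAt.comp_hasDerivAt t (hl t)).sub (ht.comp t (hq t))
  have hhmin : IsLocalMin (fun t : ℝ => φ (y + t • v) - g (‖y + t • v‖ ^ 2)) 0 := by
    filter_upwards [hlc.eventually hmin] with t ht
    rwa [hl0]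
  have h1 : HasDerivAt (fun t : ℝ => fderiv ℝ φ (y + t • v) v)
      (fderiv ℝ (fderiv ℝ φ) y v v) 0 := by
    have h0 : HasFDerivAt (fderiv ℝ φ) (fderiv ℝ (fderiv ℝ φ) y) (y + (0 : ℝ) • v) := by
      rw [hl0]
      exact (hdφ' y).hasFDerivAt
    have h1 : HasDerivAt (fun t : ℝ => fderiv ℝ φ (y + t • v)) (fderiv ℝ (fderiv ℝ φ) y v) 0 :=
      h0.comp_hasDerivAt (0 : ℝ) (hl 0)
    exact (ContinuousLinearMap.apply ℝ ℝ v).hasFDerivAt.comp_hasDerivAt (0 : ℝ) h1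
  have h2 : HasDerivAt (fun t : ℝ => g' (‖y + t • v‖ ^ 2)) (g'' * (2 * inner ℝ y v)) 0 := by
    have h0 : HasDerivAt g' g'' (‖y + (0 : ℝ) • v‖ ^ 2) := by rwa [hl0]
    have := h0.comp (0 : ℝ) (hq 0)
    rwa [hl0] at this
  have h3 : HasDerivAt (fun t : ℝ => 2 * (inner ℝ (y + t • v) v : ℝ)) (2 * ‖v‖ ^ 2) 0 := by
    have := ((hl 0).inner ℝ (hasDerivAt_const (0 : ℝ) v)).const_mul 2
    simpa only [inner_zero_right, zero_add, real_inner_self_eq_norm_sq] using this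
  have hfirst := hhmin.hasDerivAt_eq_zero hh.self_of_nhds
  have hsecond := second_deriv_nonneg_of_isLocalMin hhmin hh (h1.sub (h2.mul h3))
  rw [hl0] at hfirst hsecond
  rw [dotProduct_hess_mulVec hφ]
  constructor <;> linarith

theorem parabolic_radial_touching {n : ℕ} {w φ : En n × ℝ → ℝ} (hφ : ContDiff ℝ 2 φ)
    {p : En n × ℝ} (hp : p ∈ Qset n) (hmax : IsLocalMaxOn (fun q => w q - φ q) (Qset n) p)
    {G : ℝ → ℝ → ℝ} (hle : ∀ z s, G (‖z‖ ^ 2) s ≤ w (z, s)) (heq : w p = G (‖p.1‖ ^ 2) p.2)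
    {Gs G'' : ℝ} {G' : ℝ → ℝ} (hs : HasDerivAt (G (‖p.1‖ ^ 2)) Gs p.2)
    (hG : ∀ᶠ q in 𝓝 (‖p.1‖ ^ 2), HasDerivAt (fun q => G q p.2) (G' q) q)
    (hG' : HasDerivAt G' G'' (‖p.1‖ ^ 2)) :
    tderiv n φ p = Gs ∧ sgrad n φ p p.1 = 2 * ‖p.1‖ ^ 2 * G' (‖p.1‖ ^ 2) ∧
    ∀ v : En n, 4 * G'' * inner ℝ p.1 v ^ 2 + 2 * G' (‖p.1‖ ^ 2) * ‖v‖ ^ 2 ≤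
      (v : Fin n → ℝ) ⬝ᵥ shess n φ p *ᵥ (v : Fin n → ℝ) := by
  obtain ⟨y, s⟩ := p
  have hopen : IsOpen (Qset n) := isOpen_lt continuous_const continuous_snd
  have hmin : ∀ᶠ q in 𝓝 (y, s), φ (y, s) - G (‖y‖ ^ 2) s ≤ φ q - G (‖q.1‖ ^ 2) q.2 := by
    filter_upwards [hmax.isLocalMax (hopen.mem_nhds hp)] with q hq
    have := hle q.1 q.2
    simp only at hq heq
    linarith
  have hφx : ContDiff ℝ 2 fun z => φ (z, s) := hφ.comp (contDiff_prodMk_left s)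
  have hxmin : IsLocalMin (fun z => φ (z, s) - G (‖z‖ ^ 2) s) y :=
    (Continuous.prodMk_left s).continuousAt.eventually hmin
  have htmin : IsLocalMin (fun τ => φ (y, τ) - G (‖y‖ ^ 2) τ) s :=
    (Continuous.prodMk_right y).continuousAt.eventually hmin
  have hx := radial_touching hφx hG hG' hxmin
  refine ⟨?_, ?_, fun v => (hx v).2⟩
  · have hd : DifferentiableAt ℝ (fun τ => φ (y, τ)) s :=
      ((hφ.comp (contDiff_prodMk_right y)).differentiable two_ne_zero) s
    exact sub_eq_zero.1 (htmin.hasDerivAt_eq_zero (hd.hasDerivAt.sub hs))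
  · have := (hx y).1
    rwa [real_inner_self_eq_norm_sq] at this

theorem pucciPlus_le_of_quadratic_lower_bound {n : ℕ} {lam Lam α β μ ν : ℝ} (h : lam ≤ Lam)
    {M : Mat n} {y : En n}
    (hM : ∀ v : En n, α * inner ℝ y v ^ 2 + β * ‖v‖ ^ 2 ≤
      (v : Fin n → ℝ) ⬝ᵥ M *ᵥ (v : Fin n → ℝ)) (hlam : 0 ≤ lam)
    (hα : ∀ e, lam ≤ e → e ≤ Lam → μ ≤ e * α) (hβ : ∀ e, lam ≤ e → e ≤ Lam → ν ≤ e * β) :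
    PucciPlus n lam Lam M ≤ -(μ * ‖y‖ ^ 2 + n * ν) := by
  refine pucciPlus_le h fun b e he => neg_le_neg ?_
  calc μ * ‖y‖ ^ 2 + n * ν = ∑ k, (μ * inner ℝ y (b k) ^ 2 + ν) := by
        rw [Finset.sum_add_distrib, ← Finset.mul_sum, b.sum_sq_inner_left]
        simp
    _ ≤ _ := Finset.sum_le_sum fun k _ => by
        have h1 := mul_le_mul_of_nonneg_left (hM (b k)) (hlam.trans (he k).1)
        have h2 := mul_le_mul_of_nonneg_right (hα _ (he k).1 (he k).2) (sq_nonneg (inner ℝ y (b k)))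
        have h3 := hβ _ (he k).1 (he k).2
        rw [b.orthonormal.1 k] at h1
        linarith

theorem parabolic_operator_le_of_touching {n : ℕ} {lam Lam : ℝ} (hlam : 0 ≤ lam) (h : lam ≤ Lam)
    {w φ : En n × ℝ → ℝ} (hφ : ContDiff ℝ 2 φ)
    {p : En n × ℝ} (hp : p ∈ Qset n) (hmax : IsLocalMaxOn (fun q => w q - φ q) (Qset n) p)
    {G : ℝ → ℝ → ℝ} (hle : ∀ z s, G (‖z‖ ^ 2) s ≤ w (z, s)) (heq : w p = G (‖p.1‖ ^ 2) p.2)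
    {Gs G'' : ℝ} {G' : ℝ → ℝ} (hs : HasDerivAt (G (‖p.1‖ ^ 2)) Gs p.2)
    (hG : ∀ᶠ q in 𝓝 (‖p.1‖ ^ 2), HasDerivAt (fun q => G q p.2) (G' q) q)
    (hG' : HasDerivAt G' G'' (‖p.1‖ ^ 2)) {μ ν : ℝ}
    (hμ : ∀ e, lam ≤ e → e ≤ Lam → μ ≤ e * (4 * G''))
    (hν : ∀ e, lam ≤ e → e ≤ Lam → ν ≤ e * (2 * G' (‖p.1‖ ^ 2))) :
    tderiv n φ p + (PucciPlus n lam Lam (shess n φ p) - (1/2) * sgrad n φ p p.1) ≤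
      Gs - μ * ‖p.1‖ ^ 2 - n * ν - ‖p.1‖ ^ 2 * G' (‖p.1‖ ^ 2) := by
  obtain ⟨h1, h2, h3⟩ := parabolic_radial_touching hφ hp hmax hle heq hs hG hG'
  have := pucciPlus_le_of_quadratic_lower_bound h h3 hlam hμ hν
  rw [h1, h2]
  linarith

theorem gaussian_barrier_operator_nonpos {n : ℕ} {lam Lam a K δ : ℝ} (hlam : 0 < lam)
    (h : lam ≤ Lam) (ha : 1 / (4 * lam) < a) (hK : K = 2 * a * Lam * n + 2)
    {w φ : En n × ℝ → ℝ} (hφ : ContDiff ℝ 2 φ)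
    {p : En n × ℝ} (hp : p ∈ Qset n) (hmax : IsLocalMaxOn (fun q => w q - φ q) (Qset n) p)
    (hle : ∀ (z : En n) s,
      exp (-(K - 1) * s - a * ‖z‖ ^ 2) - δ * exp (-K * s) ≤ w (z, s))
    (heq : w p = exp (-(K - 1) * p.2 - a * ‖p.1‖ ^ 2) - δ * exp (-K * p.2))
    (hfar : K * (δ * exp (-K * p.2)) ≤
      (1 + a * (4 * lam * a - 1) * ‖p.1‖ ^ 2) * exp (-(K - 1) * p.2 - a * ‖p.1‖ ^ 2)) :
    tderiv n φ p + (PucciPlus n lam Lam (shess n φ p) - (1/2) * sgrad n φ p p.1) ≤ 0 := by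
  have ha0 : 0 < a := lt_trans (by positivity) ha
  have hexp : ∀ q τ : ℝ, HasDerivAt (fun q => exp (-(K - 1) * τ - a * q))
      (-a * exp (-(K - 1) * τ - a * q)) q := fun q τ => by
    have := (((hasDerivAt_id q).const_mul a).const_sub (-(K - 1) * τ)).exp
    simpa [mul_comm] using this
  have hs : HasDerivAt (fun τ => exp (-(K - 1) * τ - a * ‖p.1‖ ^ 2) - δ * exp (-K * τ))
      (-(K - 1) * exp (-(K - 1) * p.2 - a * ‖p.1‖ ^ 2) + K * (δ * exp (-K * p.2))) p.2 := by
    have h1 := (((hasDerivAt_id p.2).const_mul (-(K - 1))).sub_const (a * ‖p.1‖ ^ 2)).exp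
    have h2 := (((hasDerivAt_id p.2).const_mul (-K)).exp).const_mul δ
    refine (h1.sub h2).congr_deriv ?_
    simp only [id]
    ring
  have hG'' := (hexp (‖p.1‖ ^ 2) p.2).const_mul (-a)
  set E := exp (-(K - 1) * p.2 - a * ‖p.1‖ ^ 2) with hE
  have key := parabolic_operator_le_of_touching hlam.le h hφ hp hmax
    (G := fun q τ => exp (-(K - 1) * τ - a * q) - δ * exp (-K * τ)) hle heq hs
    (Eventually.of_forall fun q => (hexp q p.2).sub_const _) hG''
    (μ := 4 * lam * a ^ 2 * E) (ν := -(2 * Lam * a * E))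
    (fun e he _ => by
      have := mul_le_mul_of_nonneg_right he (show 0 ≤ a ^ 2 * E by positivity)
      linarith)
    (fun e _ he => by
      have := mul_le_mul_of_nonneg_right he (show 0 ≤ a * E by positivity)
      rw [← hE]
      linarith)
  refine key.trans ?_
  rw [← hE]
  have hKE : (K - 1) * E = (2 * a * Lam * n + 1) * E := by rw [hK]; ring
  linarith

theorem algebraic_barrier_operator_nonpos {n k : ℕ} {lam Lam m K : ℝ} (hlam : 0 < lam)
    (h : lam ≤ Lam) (hm : 0 < m) (hk : K + 1 ≤ k)
    {w φ : En n × ℝ → ℝ} (hφ : ContDiff ℝ 2 φ)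
    {p : En n × ℝ} (hp : p ∈ Qset n) (hmax : IsLocalMaxOn (fun q => w q - φ q) (Qset n) p)
    (hle : ∀ (z : En n) s, -(m * exp (-K * s) * ((1 + ‖z‖ ^ 2) ^ k)⁻¹) ≤ w (z, s))
    (heq : w p = -(m * exp (-K * p.2) * ((1 + ‖p.1‖ ^ 2) ^ k)⁻¹))
    (hfar : K + 4 * Lam * k * (k + 1) ≤ ‖p.1‖ ^ 2) :
    tderiv n φ p + (PucciPlus n lam Lam (shess n φ p) - (1/2) * sgrad n φ p p.1) ≤ 0 := by
  have hpow : ∀ (j : ℕ) (q : ℝ), 0 < 1 + q → HasDerivAt (fun q : ℝ => ((1 + q) ^ j)⁻¹)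
      (-(j * ((1 + q) ^ (j + 1))⁻¹)) q := fun j q hq => by
    have h1 := (((hasDerivAt_id q).const_add 1).pow j).inv (pow_pos hq j).ne'
    refine h1.congr_deriv ?_
    simp only [id, Pi.pow_apply]
    rcases j with _ | j
    · simp
    · rw [Nat.add_sub_cancel]
      field_simp
      ring
  set Q := ‖p.1‖ ^ 2 with hQ
  have hQ0 : 0 ≤ Q := by positivity
  have hev : ∀ᶠ q in 𝓝 Q, 0 < 1 + q :=
    (continuous_const.add continuous_id).continuousAt.eventually_const_lt (by simp; linarith)
  set c := m * exp (-K * p.2) with hc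
  have hc0 : 0 < c := by positivity
  have hs : HasDerivAt (fun τ => -(m * exp (-K * τ) * ((1 + Q) ^ k)⁻¹))
      (K * c * ((1 + Q) ^ k)⁻¹) p.2 := by
    have h2 := (((((hasDerivAt_id p.2).const_mul (-K)).exp).const_mul m).mul_const
      (((1 + Q) ^ k)⁻¹)).neg
    refine h2.congr_deriv ?_
    simp only [id, hc]
    ring
  have hG'' := ((hpow (k + 1) Q (by linarith)).const_mul (c * k))
  have key := parabolic_operator_le_of_touching hlam.le h hφ hp hmax
    (G := fun q τ => -(m * exp (-K * τ) * ((1 + q) ^ k)⁻¹)) hle heq hs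
    (G' := fun q => c * k * ((1 + q) ^ (k + 1))⁻¹)
    (hev.mono fun q hq => ((hpow k q hq).const_mul c).neg.congr_deriv (by ring)) hG''
    (μ := -(4 * Lam * (c * k * ((k + 1) * ((1 + Q) ^ (k + 2))⁻¹)))) (ν := 0)
    (fun e _ he => by
      have := mul_le_mul_of_nonneg_right he
        (show 0 ≤ c * k * ((k + 1) * ((1 + Q) ^ (k + 2))⁻¹) by positivity)
      push_cast
      linarith)
    (fun e he _ => by
      have := hlam.le.trans he
      positivity)
  refine key.trans ?_
  have h1 : ((1 + Q) ^ k)⁻¹ = (1 + Q) ^ 2 * ((1 + Q) ^ (k + 2))⁻¹ := by field_simp; ring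
  have h2 : ((1 + Q) ^ (k + 1))⁻¹ = (1 + Q) * ((1 + Q) ^ (k + 2))⁻¹ := by field_simp; ring
  rw [← hQ, h1, h2]
  have h3 : K * (1 + Q) ^ 2 + 4 * Lam * k * (k + 1) * Q - k * Q * (1 + Q) ≤ 0 := by
    have hL : 0 ≤ 4 * Lam * k * (k + 1) := by
      have := hlam.le.trans h
      positivity
    have h4 := mul_le_mul_of_nonneg_right hk hQ0
    have : K * (1 + Q) + 4 * Lam * k * (k + 1) - k * Q ≤ 0 := by linarith
    have := mul_le_mul_of_nonneg_right this (show 0 ≤ 1 + Q by linarith)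
    linarith
  have := mul_nonpos_of_nonneg_of_nonpos
    (show 0 ≤ c * ((1 + Q) ^ (k + 2))⁻¹ by positivity) h3
  linarith

theorem exp_neg_le_inv_one_add_sq_pow (k : ℕ) {ρ : ℝ} (hρ : 0 ≤ ρ) :
    ((2 * k).factorial * exp 1)⁻¹ * exp (-ρ) ≤ ((1 + ρ ^ 2) ^ k)⁻¹ := by
  rw [Real.exp_neg, ← mul_inv]
  refine inv_anti₀ (by positivity) ?_
  calc (1 + ρ ^ 2) ^ k ≤ ((1 + ρ) ^ 2) ^ k := by gcongr; nlinarith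
    _ = (1 + ρ) ^ (2 * k) := by rw [pow_mul]
    _ ≤ (2 * k).factorial * exp (1 + ρ) := by
        have := pow_div_factorial_le_exp (x := 1 + ρ) (by linarith) (2 * k)
        rwa [div_le_iff₀' (by positivity)] at this
    _ = _ := by rw [Real.exp_add, mul_assoc]

/-- **Lemma 4.4.** Construction of the special subsolution: for each `a > 1/(4λ)` there are
`r, η > 0` and a viscosity subsolution `w` of `w_s + P⁺(D²w) - (1/2) y·Dw ≤ 0` in `ℝⁿ × ℝ₊`
with `w(y,0) ≤ e^{-a|y|²}` for `|y| ≤ r`, `w(y,0) ≤ -η e^{-|y|}` for `|y| > r`, and such that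
for each `R > 0` there exists `S > 0` with `w(y,s) > 0` whenever `|y| ≤ R` and `s ≥ S`. -/
theorem special_subsolution (n : ℕ) (hn : 1 ≤ n) (lam Lam : ℝ)
    (hlam : 0 < lam) (hLam : lam ≤ Lam) :
    ∀ a : ℝ, 1/(4*lam) < a →
      ∃ r η : ℝ, 0 < r ∧ 0 < η ∧ ∃ w : En n × ℝ → ℝ,
        ContinuousOn w {p : En n × ℝ | 0 ≤ p.2} ∧
        ViscSubP n (Qset n)
          (fun M pr _ q => PucciPlus n lam Lam M - (1/2) * pr q.1) w ∧
        (∀ y : En n, ‖y‖ ≤ r → w (y, 0) ≤ Real.exp (-a * ‖y‖ ^ 2)) ∧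
        (∀ y : En n, r < ‖y‖ → w (y, 0) ≤ -η * Real.exp (-‖y‖)) ∧
        (∀ R : ℝ, 0 < R → ∃ S : ℝ, 0 < S ∧
          ∀ (y : En n) (s : ℝ), ‖y‖ ≤ R → S ≤ s → 0 < w (y, s)) := by
  intro a ha
  have ha0 : 0 < a := lt_trans (by positivity) ha
  have hLam0 : 0 < Lam := hlam.trans_le hLam
  obtain ⟨K, hK⟩ : ∃ K, K = 2 * a * Lam * n + 2 := ⟨_, rfl⟩
  have hK2 : 2 ≤ K := by
    have : 0 ≤ 2 * a * Lam * n := by positivity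
    linarith
  obtain ⟨k, hk⟩ := exists_nat_ge (K + 1)
  have hc : 0 < a * (4 * lam * a - 1) := by
    have := (div_lt_iff₀ (by positivity)).1 ha
    exact mul_pos ha0 (by linarith)
  obtain ⟨Q, hQ1, hQ2⟩ : ∃ Q : ℝ, K + 4 * Lam * k * (k + 1) ≤ Q ∧
      2 * K ≤ a * (4 * lam * a - 1) * Q :=
    ⟨max (K + 4 * Lam * k * (k + 1)) (2 * K / (a * (4 * lam * a - 1))), le_max_left _ _,
      (div_le_iff₀' hc).1 (le_max_right _ _)⟩
  obtain ⟨δ, hδ0, hδ⟩ : ∃ δ : ℝ, 0 < δ ∧ K * δ = exp (-(a * Q)) :=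
    ⟨exp (-(a * Q)) / K, by positivity, by field_simp⟩
  have hfar : ∀ q s : ℝ, 0 ≤ s →
      exp (-(K - 1) * s - a * q) < K * (δ * exp (-K * s)) → Q ≤ q := by
    intro q s hs hlt
    rw [← mul_assoc, hδ, ← Real.exp_add, Real.exp_lt_exp] at hlt
    exact le_of_mul_le_mul_left (by linarith) ha0
  set f : En n × ℝ → ℝ := fun p =>
    exp (-(K - 1) * p.2 - a * ‖p.1‖ ^ 2) - δ * exp (-K * p.2) with hf
  set g : En n × ℝ → ℝ := fun p => -(δ / 4 * exp (-K * p.2) * ((1 + ‖p.1‖ ^ 2) ^ k)⁻¹) with hg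
  have hg0 : ∀ p, g p ≤ 0 := fun p => neg_nonpos.2 (by positivity)
  obtain ⟨r, hr1, hr⟩ : ∃ r : ℝ, 1 ≤ r ∧ exp (-(a * r)) ≤ δ / 2 := by
    refine ⟨max 1 (-log (δ / 2) / a), le_max_left _ _, ?_⟩
    rw [← Real.le_log_iff_exp_le (by positivity)]
    have := (div_le_iff₀' ha0).1 (le_max_right 1 (-log (δ / 2) / a))
    linarith
  have hη1 : ((2 * k).factorial * exp 1)⁻¹ ≤ 1 := by
    refine inv_le_one_of_one_le₀ (one_le_mul_of_one_le_of_one_le ?_ (Real.one_le_exp zero_le_one))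
    exact_mod_cast Nat.factorial_pos _
  refine ⟨r, δ / 4 * ((2 * k).factorial * exp 1)⁻¹, by linarith, by positivity,
    fun p => max (f p) (g p), Continuous.continuousOn ?_, ?_, ?_, ?_, ?_⟩
  · refine Continuous.max (by fun_prop) ?_
    refine (Continuous.mul (by fun_prop) (Continuous.inv₀ (by fun_prop) fun p => ?_)).neg
    positivity
  · intro p hp φ hφ hmax
    have hs : 0 < p.2 := hp
    have hD : 0 < δ * exp (-K * p.2) := by positivity
    rcases le_or_gt (g p) (f p) with hfg | hfg
    · refine gaussian_barrier_operator_nonpos hlam hLam ha hK hφ hp hmax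
        (fun z s => le_max_left (f (z, s)) _) (max_eq_left hfg) ?_
      have hE : 0 < exp (-(K - 1) * p.2 - a * ‖p.1‖ ^ 2) := exp_pos _
      rcases le_or_gt (K * (δ * exp (-K * p.2))) (exp (-(K - 1) * p.2 - a * ‖p.1‖ ^ 2))
        with hle | hlt
      · have : 0 ≤ a * (4 * lam * a - 1) * ‖p.1‖ ^ 2 *
          exp (-(K - 1) * p.2 - a * ‖p.1‖ ^ 2) := by positivity
        linarith
      · have hq := mul_le_mul_of_nonneg_left (hfar _ _ hs.le hlt) hc.le
        have hψ : ((1 + ‖p.1‖ ^ 2) ^ k)⁻¹ ≤ 1 :=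
          inv_le_one_of_one_le₀ (one_le_pow₀ (by nlinarith [sq_nonneg ‖p.1‖]))
        have hψ' := mul_le_mul_of_nonneg_left hψ hD.le
        simp only [hf, hg] at hfg
        have hE' : 3 / 4 * (δ * exp (-K * p.2)) ≤
            exp (-(K - 1) * p.2 - a * ‖p.1‖ ^ 2) := by linarith
        have h1 := mul_le_mul_of_nonneg_left hE' (show 0 ≤ 2 * K by linarith)
        have h2 := mul_le_mul_of_nonneg_right
          (show 2 * K ≤ 1 + a * (4 * lam * a - 1) * ‖p.1‖ ^ 2 by linarith) hE.le
        have : 0 < K * (δ * exp (-K * p.2)) := by positivity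
        linarith
    · refine algebraic_barrier_operator_nonpos hlam hLam (by positivity) hk hφ hp hmax
        (fun z s => le_max_right (f (z, s)) (g (z, s))) (max_eq_right hfg.le)
        (hQ1.trans (hfar _ _ hs.le ?_))
      have := hfg.trans_le (hg0 p)
      simp only [hf] at this
      nlinarith
  · intro y _
    refine max_le ?_ ((hg0 _).trans (exp_pos _).le)
    simp only [hf, mul_zero, zero_sub, Real.exp_zero, mul_one, ← neg_mul]
    linarith
  · intro y hy
    have hy0 : 0 ≤ ‖y‖ := norm_nonneg y
    refine max_le ?_ ?_
    · have h1 : exp (-(a * ‖y‖ ^ 2)) ≤ exp (-(a * r)) := by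
        rw [Real.exp_le_exp, neg_le_neg_iff]
        exact mul_le_mul_of_nonneg_left (by nlinarith) ha0.le
      have h2 : ((2 * k).factorial * exp 1)⁻¹ * exp (-‖y‖) ≤ 1 :=
        mul_le_one₀ hη1 (exp_pos _).le (Real.exp_le_one_iff.2 (by linarith))
      simp only [hf, mul_zero, zero_sub, Real.exp_zero, mul_one]
      nlinarith
    · have := exp_neg_le_inv_one_add_sq_pow k hy0
      simp only [hg, mul_zero, Real.exp_zero, mul_one]
      nlinarith
  · intro R hR
    refine ⟨|log δ| + a * R ^ 2 + 1, by positivity, fun y s hy hs => lt_max_of_lt_left ?_⟩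
    have h1 : a * ‖y‖ ^ 2 ≤ a * R ^ 2 := by gcongr
    have h2 := le_abs_self (log δ)
    simp only [hf, sub_pos]
    rw [← Real.exp_log hδ0, ← Real.exp_add, Real.exp_lt_exp]
    linarith
end
end
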